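/- There exists a Slovak space; that is, there exists a compact metric space X with at least three points and a minimal homeomorphism T : X → X such that every self-homeomorphism of X equals T^n for some n ∈ ℤ. -/

import Mathlib

open Set Filter Topology

/-- Integer powers (iterates) of a self-homeomorphism: `hzpow T n = Tⁿ` for `n : ℤ`. -/
def hzpow {X : Type*} [TopologicalSpace X] (T : X ≃ₜ X) : ℤ → (X ≃ₜ X)
  | Int.ofNat n => (fun S => S.trans T)^[n] (Homeomorph.refl X)
  | Int.negSucc n => ((fun S => S.trans T)^[n + 1] (Homeomorph.refl X)).symm

/-- A self-map of a topological space is minimal if every forward orbit is dense. -/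
def IsMinimal {X : Type*} [TopologicalSpace X] (T : X → X) : Prop :=
  ∀ x : X, Dense (Set.range fun n : ℕ => T^[n] x)

set_option linter.unusedSectionVars false

namespace Slovak

theorem hz_iter {X : Type*} [TopologicalSpace X] (T : X ≃ₜ X) (n : ℕ) (x : X) :
    ((fun S : X ≃ₜ X => S.trans T)^[n] (Homeomorph.refl X)) x = T^[n] x := by
  induction n with
  | zero => rfl
  | succ n ih =>
    rw [Function.iterate_succ_apply', Function.iterate_succ_apply', ← ih]; rfl

theorem hz_succ {X : Type*} [TopologicalSpace X] (T : X ≃ₜ X) (n : ℤ) (x : X) :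
    hzpow T (n + 1) x = T (hzpow T n x) := by
  rcases n with n | n
  · change ((fun S : X ≃ₜ X => S.trans T)^[n+1] (Homeomorph.refl X)) x
      = T (((fun S : X ≃ₜ X => S.trans T)^[n] (Homeomorph.refl X)) x)
    rw [hz_iter, hz_iter, Function.iterate_succ_apply']
  · have key : ∀ m : ℕ, ((fun S : X ≃ₜ X => S.trans T)^[m] (Homeomorph.refl X)).symm x
        = T (((fun S : X ≃ₜ X => S.trans T)^[m+1] (Homeomorph.refl X)).symm x) := by
      intro m
      rw [Homeomorph.symm_apply_eq, hz_iter, ← Function.iterate_succ_apply, ← hz_iter,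
        Homeomorph.apply_symm_apply]
    rcases n with _ | n
    · exact key 0
    · have : Int.negSucc (n + 1) + 1 = Int.negSucc n := by omega
      rw [this]
      exact key (n + 1)

/-- The data: a compact group with a one-parameter subgroup and the functions defining the
singularity. -/
structure Data (Y : Type) [TopologicalSpace Y] [AddCommGroup Y] where
  φ : ℝ →+ Y
  cont : Continuous φ
  inj : Function.Injective φ
  τ : ℝ
  τpos : 0 < τ
  dense : ∀ y : Y, Dense (range fun n : ℕ => y + φ (n * τ))
  lift : ∀ (γ : C(unitInterval, Y)) (t : ℝ), γ 0 = φ t →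
    ∃ h : C(unitInterval, ℝ), h 0 = t ∧ ∀ s, γ s = φ (h s)
  r : Y → ℝ
  g : Y → ℝ
  r_cont : Continuous r
  g_cont : Continuous g
  r_zero : ∀ y, r y = 0 ↔ y = 0
  g_le : ∀ y, |g y| ≤ |r y|
  left : ∃ ε > 0, ∀ t ∈ Icc (-ε) 0, g (φ t) = 0
  osc : ∀ η > 0, ∀ v ∈ Icc (-1 : ℝ) 1, ∃ t ∈ Ioo 0 η, g (φ t) = v * r (φ t)

variable {Y : Type} [TopologicalSpace Y] [AddCommGroup Y] [IsTopologicalAddGroup Y]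

namespace Data

variable (d : Data Y)

/-- The carrier. -/
def C : Set (Y × (ℤ → ℝ)) :=
  {p | ∀ k : ℤ, |p.2 k| ≤ 1 ∧ d.r (p.1 + d.φ (k * d.τ)) * p.2 k = d.g (p.1 + d.φ (k * d.τ))}

theorem C_closed : IsClosed d.C := by
  have : d.C = ⋂ k : ℤ, ({p : Y × (ℤ → ℝ) | |p.2 k| ≤ 1} ∩
      {p | d.r (p.1 + d.φ (k * d.τ)) * p.2 k = d.g (p.1 + d.φ (k * d.τ))}) := by
    ext p; simp [C]
  rw [this]
  have hr := d.r_cont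
  have hg := d.g_cont
  refine isClosed_iInter fun k => IsClosed.inter (isClosed_le ?_ ?_) (isClosed_eq ?_ ?_) <;> fun_prop

theorem C_compact [CompactSpace Y] : IsCompact d.C := by
  refine (isCompact_univ.prod (isCompact_univ_pi (s := fun _ : ℤ => Icc (-1 : ℝ) 1)
    fun _ => isCompact_Icc)).of_isClosed_subset d.C_closed ?_
  intro p hp
  refine ⟨mem_univ _, fun k _ => ?_⟩
  exact abs_le.1 (hp k).1

/-- The space. -/
abbrev X := ↥d.C

theorem shift_aux (y : Y) (m k : ℤ) :
    y + d.φ (m * d.τ) + d.φ (k * d.τ) = y + d.φ ((m + k : ℤ) * d.τ) := by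
  rw [add_assoc, ← map_add]; congr 2; push_cast; ring

theorem shift_mem (m : ℤ) {p : Y × (ℤ → ℝ)} (hp : p ∈ d.C) :
    ((p.1 + d.φ (m * d.τ), fun k => p.2 (m + k)) : Y × (ℤ → ℝ)) ∈ d.C := by
  intro k
  simp only [shift_aux]
  exact hp (m + k)

/-- The homeomorphism. -/
def T : d.X ≃ₜ d.X where
  toFun x := ⟨_, d.shift_mem 1 x.2⟩
  invFun x := ⟨_, d.shift_mem (-1) x.2⟩
  left_inv x := by
    apply Subtype.ext
    apply Prod.ext
    · simp only [shift_aux]; simp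
    · funext k; simp
  right_inv x := by
    apply Subtype.ext
    apply Prod.ext
    · simp only [shift_aux]; simp
    · funext k; simp
  continuous_toFun := by
    refine Continuous.subtype_mk (Continuous.prodMk ?_ (continuous_pi fun k => ?_)) _ <;> fun_prop
  continuous_invFun := by
    refine Continuous.subtype_mk (Continuous.prodMk ?_ (continuous_pi fun k => ?_)) _ <;> fun_prop

/-- The projection. -/
def π (x : d.X) : Y := x.1.1

theorem π_cont : Continuous d.π := by unfold π; fun_prop

theorem π_T (x : d.X) : d.π (d.T x) = d.π x + d.φ d.τ := by
  simp [π, T]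

theorem π_iter (n : ℕ) (x : d.X) : d.π (d.T^[n] x) = d.π x + d.φ (n * d.τ) := by
  induction n with
  | zero => simp
  | succ n ih =>
    rw [Function.iterate_succ_apply', π_T, ih, add_assoc, ← map_add]; congr 2; push_cast; ring

theorem π_hz (n : ℤ) (x : d.X) : d.π (hzpow d.T n x) = d.π x + d.φ (n * d.τ) := by
  induction n with
  | zero => simp [hzpow]
  | succ n ih =>
    rw [hz_succ, π_T, ih, add_assoc, ← map_add]; congr 2; push_cast; ring
  | pred n ih =>
    have := hz_succ d.T (-(n:ℤ) - 1) x
    rw [sub_add_cancel] at this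
    rw [this, π_T] at ih
    rw [eq_sub_of_add_eq ih, add_sub_assoc, ← map_sub]; congr 2; push_cast; ring

/-- The section function. -/
noncomputable def f (y : Y) : ℝ := d.g y / d.r y

theorem f_le (y : Y) : |d.f y| ≤ 1 := by
  unfold f; rw [abs_div]
  exact div_le_one_of_le₀ (d.g_le y) (abs_nonneg _)

theorem f_mul (y : Y) : d.r y * d.f y = d.g y := by
  unfold f
  by_cases h : d.r y = 0
  · have := d.g_le y
    rw [h] at this
    simp at this
    simp [h, this]
  · field_simp

theorem f_cont {y : Y} (hy : y ≠ 0) : ContinuousAt d.f y :=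
  d.g_cont.continuousAt.div d.r_cont.continuousAt (by rwa [Ne, d.r_zero])

theorem eq_f {y : Y} (hy : y ≠ 0) {u : ℝ} (hu : d.r y * u = d.g y) : u = d.f y := by
  have : d.r y ≠ 0 := by rwa [Ne, d.r_zero]
  unfold f; field_simp; linarith

theorem coord {x : d.X} {k : ℤ} (h : d.π x + d.φ (k * d.τ) ≠ 0) :
    x.1.2 k = d.f (d.π x + d.φ (k * d.τ)) := d.eq_f h (x.2 k).2

/-- The section. -/
noncomputable def sec (y : Y) : d.X :=
  ⟨(y, fun k => d.f (y + d.φ (k * d.τ))), fun _ => ⟨d.f_le _, d.f_mul _⟩⟩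

@[simp] theorem π_sec (y : Y) : d.π (d.sec y) = y := rfl

theorem eq_sec {x : d.X} (h : ∀ k : ℤ, d.π x + d.φ (k * d.τ) ≠ 0) : x = d.sec (d.π x) := by
  apply Subtype.ext
  apply Prod.ext
  · rfl
  · funext k; exact d.coord (h k)

/-- The osc property for f. -/
theorem osc' {η : ℝ} (hη : 0 < η) {v : ℝ} (hv : |v| ≤ 1) : ∃ t ∈ Ioo 0 η, d.f (d.φ t) = v := by
  obtain ⟨t, ht, h⟩ := d.osc η hη v (abs_le.1 hv)
  refine ⟨t, ht, ?_⟩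
  symm
  apply d.eq_f
  · rw [← map_zero d.φ]; exact fun h => ht.1.ne' (d.inj h)
  · rw [h]; ring

theorem φ_add_eq_zero {t s : ℝ} : d.φ t + d.φ s = 0 ↔ t + s = 0 := by
  rw [← map_add, ← map_zero d.φ, d.inj.eq_iff]

theorem tendsto_X {ι : Type*} {l : Filter ι} {u : ι → d.X} {x : d.X}
    (h1 : Tendsto (fun i => d.π (u i)) l (𝓝 (d.π x)))
    (h2 : ∀ k, Tendsto (fun i => (u i).1.2 k) l (𝓝 (x.1.2 k))) : Tendsto u l (𝓝 x) := by
  rw [tendsto_subtype_rng]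
  exact h1.prodMk_nhds (tendsto_pi_nhds.2 h2)

/-- Regular sections are dense. -/
theorem dense_reg (x : d.X) :
    x ∈ closure (d.sec '' {y | ∀ k : ℤ, y + d.φ (k * d.τ) ≠ 0}) := by
  by_cases h : ∀ k : ℤ, d.π x + d.φ (k * d.τ) ≠ 0
  · rw [d.eq_sec h]; exact subset_closure ⟨_, h, rfl⟩
  push Not at h
  obtain ⟨k, hk⟩ := h
  have ex : ∀ n : ℕ, ∃ t ∈ Ioo 0 (min d.τ (1 / ((n : ℝ) + 1))), d.f (d.φ t) = x.1.2 k := fun n =>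
    d.osc' (lt_min d.τpos (by positivity)) (x.2 k).1
  choose t ht htf using ex
  have ht0 : Tendsto t atTop (𝓝 0) :=
    squeeze_zero (fun n => (ht n).1.le) (fun n => ((ht n).2.trans_le (min_le_right _ _)).le)
      tendsto_one_div_add_atTop_nhds_zero_nat
  have hy : d.π x = d.φ (-(k * d.τ)) := by rw [map_neg]; exact eq_neg_of_add_eq_zero_left hk
  have hlim : Tendsto (fun n => d.π x + d.φ (t n)) atTop (𝓝 (d.π x)) := by
    have := (d.cont.tendsto 0).comp ht0
    simpa using tendsto_const_nhds.add this
  refine mem_closure_of_tendsto (f := fun n => d.sec (d.π x + d.φ (t n))) (b := atTop)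
    (d.tendsto_X hlim ?_) (Eventually.of_forall fun n => ⟨_, ?_, rfl⟩)
  · intro j
    by_cases hj : j = k
    · subst hj
      refine tendsto_const_nhds.congr fun n => ?_
      change _ = d.f (d.π x + d.φ (t n) + d.φ (j * d.τ))
      rw [add_right_comm, hk, zero_add, htf]
    · have hne : d.π x + d.φ (j * d.τ) ≠ 0 := by
        rw [hy, Ne, φ_add_eq_zero]
        intro h
        apply hj
        have : ((j : ℝ) - k) * d.τ = 0 := by linarith
        rcases mul_eq_zero.1 this with h | h
        · exact_mod_cast sub_eq_zero.1 h
        · exact absurd h d.τpos.ne'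
      rw [d.coord hne]
      exact (d.f_cont hne).tendsto.comp (hlim.add tendsto_const_nhds)
  · intro j
    rw [hy, ← map_add, Ne, φ_add_eq_zero]
    intro h
    have h1 := (ht n).1
    have h2 := (ht n).2.trans_le (min_le_left _ _)
    have h3 : t n = ((k - j : ℤ) : ℝ) * d.τ := by push_cast; linarith
    rw [h3] at h1 h2
    have h4 : (0:ℝ) < ((k - j : ℤ) : ℝ) := pos_of_mul_pos_left h1 d.τpos.le
    have h5 : ((k - j : ℤ) : ℝ) < 1 := by nlinarith [d.τpos]
    have h6 : 0 < k - j := by exact_mod_cast h4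
    have h7 : k - j < 1 := by exact_mod_cast h5
    omega

theorem minimal [CompactSpace Y] [T2Space Y] : IsMinimal d.T := by
  intro x
  have : CompactSpace d.X := isCompact_iff_compactSpace.1 d.C_compact
  set A := closure (range fun n : ℕ => d.T^[n] x) with hA
  have hπ : IsClosed (d.π '' A) := (isClosed_closure.isCompact.image d.π_cont).isClosed
  have hall : ∀ y, y ∈ d.π '' A := by
    intro y
    have := d.dense (d.π x) y
    refine hπ.closure_subset_iff.2 ?_ this
    rintro _ ⟨n, rfl⟩
    exact ⟨_, subset_closure ⟨n, rfl⟩, d.π_iter n x⟩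
  intro z
  refine isClosed_closure.closure_subset_iff.2 ?_ (d.dense_reg z)
  rintro _ ⟨y, hy, rfl⟩
  obtain ⟨w, hw, rfl⟩ := hall y
  rw [← d.eq_sec hy]; exact hw

theorem sec_cont_at {E : Type*} [TopologicalSpace E] {u : E → Y} {s : Set E} {a : E}
    (hu : ContinuousWithinAt u s a)
    (h : ∀ k : ℤ, ContinuousWithinAt (fun e => d.f (u e + d.φ (k * d.τ))) s a) :
    ContinuousWithinAt (fun e => d.sec (u e)) s a := d.tendsto_X hu h

/-- path from sections. -/
theorem joined_sec (y : Y) {a b : ℝ} (hab : a ≤ b)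
    (h : ∀ k : ℤ, ContinuousOn (fun t => d.f (y + d.φ t + d.φ (k * d.τ))) (Icc a b)) :
    Joined (d.sec (y + d.φ a)) (d.sec (y + d.φ b)) := by
  have hc := d.cont
  have hcon : ContinuousOn (fun t => d.sec (y + d.φ t)) (Icc a b) := fun t ht =>
    d.sec_cont_at (by fun_prop) fun k => h k t ht
  refine (JoinedIn.ofLine (F := univ) (f := fun s : ℝ => d.sec (y + d.φ (a + s * (b - a)))) ?_
    (by simp) (by simp) (subset_univ _)).joined
  refine hcon.comp (f := fun s : ℝ => a + s * (b - a)) (by fun_prop) ?_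
  intro s hs
  constructor <;> nlinarith [hs.1, hs.2]

theorem dense_comp [CompactSpace Y] [T2Space Y] {x : d.X} (hx : d.π x ∉ range d.φ) :
    Dense (pathComponent x) := by
  refine (d.minimal x).mono ?_
  rintro _ ⟨n, rfl⟩
  have hne : ∀ t, d.π x + d.φ t ≠ 0 := fun t h => hx ⟨-t, by
    rw [map_neg]; exact (eq_neg_of_add_eq_zero_left h).symm⟩
  have h1 : x = d.sec (d.π x + d.φ 0) := by
    rw [map_zero, add_zero]; exact d.eq_sec fun k => hne _
  have h2 : d.T^[n] x = d.sec (d.π x + d.φ (n * d.τ)) := by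
    rw [← π_iter]; apply d.eq_sec
    intro k; rw [π_iter, add_assoc, ← map_add]; exact hne _
  change Joined x (d.T^[n] x)
  rw [h2]
  conv => enter [1]; rw [h1]
  have hc := d.cont
  refine d.joined_sec _ (by have := d.τpos; positivity) fun k t _ => ContinuousAt.continuousWithinAt ?_
  refine ContinuousAt.comp (g := d.f) (d.f_cont ?_) (by fun_prop)
  rw [add_assoc, ← map_add]; exact hne _

/-- The special path components. -/
def A (k : ℤ) : Set d.X := {x | ∃ t ∈ Ioc ((k - 1) * d.τ) (k * d.τ), d.π x = d.φ t}

theorem A_exists {x : d.X} (hx : d.π x ∈ range d.φ) : ∃ k, x ∈ d.A k := by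
  obtain ⟨t, ht⟩ := hx
  refine ⟨⌈t / d.τ⌉, t, ⟨?_, ?_⟩, ht.symm⟩
  · have := Int.ceil_lt_add_one (t / d.τ)
    rw [← lt_div_iff₀ d.τpos]; linarith
  · rw [← div_le_iff₀ d.τpos]; exact Int.le_ceil _

theorem A_disj {x : d.X} {j k : ℤ} (hj : x ∈ d.A j) (hk : x ∈ d.A k) : j = k := by
  obtain ⟨t, ht, h⟩ := hj
  obtain ⟨s, hs, h'⟩ := hk
  obtain rfl : t = s := d.inj (h.symm.trans h')
  have h1 : ((j:ℝ) - 1) < k := lt_of_mul_lt_mul_right (ht.1.trans_le hs.2) d.τpos.le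
  have h2 : ((k:ℝ) - 1) < j := lt_of_mul_lt_mul_right (hs.1.trans_le ht.2) d.τpos.le
  have h3 : j - 1 < k := by exact_mod_cast h1
  have h4 : k - 1 < j := by exact_mod_cast h2
  omega

/-- points over the right end belong to A k -/
theorem A_end {x : d.X} {k : ℤ} (h : d.π x = d.φ (k * d.τ)) : x ∈ d.A k :=
  ⟨k * d.τ, ⟨by nlinarith [d.τpos], le_rfl⟩, h⟩

theorem f_left : ContinuousWithinAt (fun t => d.f (d.φ t)) (Iic 0) 0 := by
  obtain ⟨ε, hε, h⟩ := d.left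
  have : (fun t => d.f (d.φ t)) =ᶠ[𝓝[≤] 0] fun _ => 0 := by
    filter_upwards [self_mem_nhdsWithin,
      mem_nhdsWithin_of_mem_nhds (Ioi_mem_nhds (neg_lt_zero.2 hε))] with t h1 h2
    simp [f, h t ⟨le_of_lt h2, h1⟩]
  exact continuousWithinAt_const.congr_of_eventuallyEq this (by simp [f, (d.r_zero 0).2 rfl])

theorem A_joined {x : d.X} {k : ℤ} (hx : x ∈ d.A k) : Joined x (d.sec (d.φ (k * d.τ))) := by
  obtain ⟨t, ht, h⟩ := hx
  have hτ := d.τpos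
  have hc := d.cont
  rcases eq_or_lt_of_le ht.2 with rfl | hlt
  · -- within the fibre
    rw [← h]
    have hmem : ∀ s ∈ Icc (0:ℝ) 1, ((d.π x, fun j => (1 - s) * x.1.2 j + s * (d.sec (d.π x)).1.2 j) :
        Y × (ℤ → ℝ)) ∈ d.C := by
      intro s hs j
      have h1 := x.2 j
      have h2 := (d.sec (d.π x)).2 j
      refine ⟨?_, ?_⟩
      · rw [abs_le]
        have a1 := abs_le.1 h1.1
        have a2 := abs_le.1 h2.1
        constructor <;> nlinarith [hs.1, hs.2]
      · have e1 := h1.2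
        have e2 := h2.2
        change d.r (d.π x + d.φ (j * d.τ)) * _ = d.g (d.π x + d.φ (j * d.τ)) at e1
        change d.r (d.π x + d.φ (j * d.τ)) * _ = d.g (d.π x + d.φ (j * d.τ)) at e2
        linear_combination (1 - s) * e1 + s * e2
    refine ⟨⟨⟨fun s => ⟨_, hmem s s.2⟩, ?_⟩, ?_, ?_⟩⟩
    · refine Continuous.subtype_mk (Continuous.prodMk ?_ (continuous_pi fun k => ?_)) _ <;> fun_prop
    · apply Subtype.ext; apply Prod.ext
      · rfl
      · funext j; simp
    · apply Subtype.ext; apply Prod.ext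
      · rfl
      · funext j; simp
  · have hne : ∀ (s : ℝ) (j : ℤ), (k - 1) * d.τ < s → s ≤ k * d.τ → s + j * d.τ = 0 →
        s = k * d.τ := by
      intro s j h1 h2 h3
      have h4 : s = ((-j : ℤ) : ℝ) * d.τ := by push_cast; linarith
      rw [h4] at h1 h2
      have h5 := lt_of_mul_lt_mul_right h1 hτ.le
      have h6 := le_of_mul_le_mul_right h2 hτ
      have h7 : k - 1 < -j := by exact_mod_cast h5
      have h8 : -j ≤ k := by exact_mod_cast h6
      have : -j = k := by omega
      rw [h4, this]
    have hx : x = d.sec (0 + d.φ t) := by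
      rw [zero_add, ← h]; apply d.eq_sec
      intro j hj
      rw [h, φ_add_eq_zero] at hj
      exact hlt.ne (hne t j ht.1 ht.2 hj)
    rw [hx, ← zero_add (d.φ (k * d.τ))]
    refine d.joined_sec 0 hlt.le fun j s hs => ?_
    have hfun : (fun t => d.f (0 + d.φ t + d.φ (j * d.τ))) = fun t => d.f (d.φ (t + j * d.τ)) := by
      funext t; rw [zero_add, map_add]
    rw [hfun]
    by_cases h0 : s + j * d.τ = 0
    · have hsk := hne s j (ht.1.trans_le hs.1) hs.2 h0
      have := d.f_left
      rw [← h0] at this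
      refine ContinuousWithinAt.comp (f := fun t => t + j * d.τ) this (by fun_prop) ?_
      intro u hu
      rw [mem_Iic, hsk]; linarith [hu.2]
    · refine ContinuousAt.continuousWithinAt ?_
      refine ContinuousAt.comp (g := d.f) (d.f_cont ?_) (by fun_prop)
      rw [← map_zero d.φ]; exact fun h => h0 (d.inj h)

/-- No path crosses a singular fibre from left to right. -/
theorem cross (γ : C(unitInterval, d.X)) (h : C(unitInterval, ℝ))
    (hh : ∀ s, d.π (γ s) = d.φ (h s)) (m : ℤ) (h0 : h 0 ≤ m * d.τ) : h 1 ≤ m * d.τ := by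
  by_contra hcon
  push Not at hcon
  set S : Set unitInterval := {s | h s ≤ m * d.τ} with hS
  have hSc : IsCompact S := (isClosed_le h.continuous continuous_const).isCompact
  obtain ⟨a, haS, ha⟩ := hSc.exists_isGreatest ⟨0, h0⟩
  have ha1 : a < 1 := lt_of_le_of_ne a.2.2 (by rintro rfl; exact absurd haS (not_le.2 hcon))
  have hpos : ∀ s, a < s → m * d.τ < h s := fun s hs => by
    by_contra hc
    exact absurd (ha (show s ∈ S from not_lt.1 hc)) (not_le.2 hs)
  have hu : Continuous fun s => (γ s).1.2 (-m) := by fun_prop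
  have hval : ∀ s, a < s → (γ s).1.2 (-m) = d.f (d.φ (h s - m * d.τ)) := by
    intro s hs
    have e : d.π (γ s) + d.φ ((-m : ℤ) * d.τ) = d.φ (h s - m * d.τ) := by
      rw [hh, ← map_add]; congr 1; push_cast; ring
    rw [d.coord, e]
    rw [e, ← map_zero d.φ]
    intro hc
    have := d.inj hc
    linarith [hpos s hs]
  have hev : ∀ᶠ s in 𝓝 a, |(γ s).1.2 (-m) - (γ a).1.2 (-m)| < 1 / 2 := by
    have := hu.continuousAt (x := a) |>.eventually (Metric.ball_mem_nhds _ (by norm_num : (0:ℝ) < 1/2))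
    simpa [Real.dist_eq] using this
  obtain ⟨b₀, hab, hb₀⟩ := (mem_nhdsGE_iff_exists_Ico_subset' ha1).1 (mem_nhdsWithin_of_mem_nhds hev)
  obtain ⟨b, hb', hbb⟩ := exists_between (show a < b₀ from hab)
  have hb : Icc a b ⊆ {s | |(γ s).1.2 (-m) - (γ a).1.2 (-m)| < 1 / 2} :=
    (Icc_subset_Ico_right hbb).trans hb₀
  have hbp := hpos b hb'
  have main : ∀ v : ℝ, |v| ≤ 1 → |v - (γ a).1.2 (-m)| < 1 / 2 := by
    intro v hv
    obtain ⟨t, ht, htv⟩ := d.osc' (sub_pos.2 hbp) hv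
    have hivt := intermediate_value_Icc hb'.le h.continuous.continuousOn
    have haS' : h a ≤ m * d.τ := haS
    obtain ⟨s, hs, hst⟩ := hivt (show t + m * d.τ ∈ Icc (h a) (h b) from
      ⟨by linarith [ht.1], by linarith [ht.2]⟩)
    have has : a < s := lt_of_le_of_ne hs.1 (by rintro rfl; linarith [ht.1])
    have := hb hs
    have e := hval s has
    rw [hst, add_sub_cancel_right, htv] at e
    rw [← e]; exact this
  have m1 := abs_lt.1 (main 1 (by norm_num))
  have m2 := abs_lt.1 (main (-1) (by norm_num))
  linarith [m1.1, m1.2, m2.1, m2.2]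

theorem A_path {x y : d.X} {k : ℤ} (hx : x ∈ d.A k) (hxy : Joined x y) : y ∈ d.A k := by
  obtain ⟨t, ht, h⟩ := hx
  obtain ⟨γ⟩ := hxy
  obtain ⟨l, hl0, hl⟩ := d.lift ⟨fun s => d.π (γ s), d.π_cont.comp γ.continuous⟩ t (by simpa using h)
  simp only [ContinuousMap.coe_mk] at hl
  refine ⟨l 1, ⟨?_, ?_⟩, by simpa using hl 1⟩
  · by_contra hc
    have := d.cross ⟨fun s => γ (unitInterval.symm s), by fun_prop⟩
      ⟨fun s => l (unitInterval.symm s), by fun_prop⟩ (fun s => hl _) (k - 1)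
      (by simpa using not_lt.1 hc)
    simp [hl0] at this
    linarith [ht.1]
  · exact d.cross γ.toContinuousMap l hl k (by rw [hl0]; exact ht.2)

theorem A_eq {x : d.X} {k : ℤ} (hx : x ∈ d.A k) : pathComponent x = d.A k := by
  ext y
  exact ⟨fun h => d.A_path hx h, fun h => (d.A_joined hx).trans (d.A_joined h).symm⟩

theorem A_closure [T2Space Y] {x : d.X} {k : ℤ} (hx : x ∈ closure (d.A k)) :
    ∃ t ∈ Icc ((k - 1) * d.τ) (k * d.τ), d.π x = d.φ t := by
  have hcl : IsClosed (d.π ⁻¹' (d.φ '' Icc ((k - 1) * d.τ) (k * d.τ))) :=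
    (isCompact_Icc.image d.cont).isClosed.preimage d.π_cont
  obtain ⟨t, ht, h⟩ := hcl.closure_subset_iff.2 (by
    rintro y ⟨t, ht, h⟩
    exact ⟨t, ⟨ht.1.le, ht.2⟩, h.symm⟩) hx
  exact ⟨t, ht, h.symm⟩

theorem A_bdry [T2Space Y] {x : d.X} {k : ℤ} (hx : x ∈ closure (d.A k)) (hx' : x ∉ d.A k) :
    d.π x = d.φ ((k - 1 : ℤ) * d.τ) := by
  obtain ⟨t, ht, h⟩ := d.A_closure hx
  rcases eq_or_lt_of_le ht.1 with rfl | hlt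
  · rw [h]; push_cast; rfl
  · exact absurd ⟨t, ⟨hlt, ht.2⟩, h⟩ hx'

theorem A_bdry_exists [CompactSpace Y] [T2Space Y] (k : ℤ) : ∃ x ∈ closure (d.A k), x ∉ d.A k := by
  have : CompactSpace d.X := isCompact_iff_compactSpace.1 d.C_compact
  have hπ : IsClosed (d.π '' closure (d.A k)) :=
    (isClosed_closure.isCompact.image d.π_cont).isClosed
  have hlt : ((k:ℝ) - 1) * d.τ < k * d.τ := by nlinarith [d.τpos]
  have hsub : Ioc (((k:ℝ) - 1) * d.τ) (k * d.τ) ⊆ d.φ ⁻¹' (d.π '' closure (d.A k)) := by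
    intro t ht
    exact ⟨d.sec (d.φ t), subset_closure ⟨t, ht, rfl⟩, rfl⟩
  have := (hπ.preimage d.cont).closure_subset_iff.2 hsub
  rw [closure_Ioc hlt.ne] at this
  obtain ⟨x, hx, h⟩ := this ⟨le_rfl, hlt.le⟩
  refine ⟨x, hx, ?_⟩
  rintro ⟨t, ht, h'⟩
  have := d.inj (h.symm.trans h')
  exact ht.1.ne this

theorem A_not_dense [T2Space Y] (k : ℤ) : ¬ Dense (d.A k) := by
  intro h
  obtain ⟨t, ht, h'⟩ := d.A_closure (h (d.sec (d.φ (k * d.τ + 1))))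
  have := d.inj h'
  linarith [ht.2]

theorem image_comp {X : Type*} [TopologicalSpace X] (S : X ≃ₜ X) (x : X) :
    S '' pathComponent x = pathComponent (S x) := by
  ext y
  constructor
  · rintro ⟨z, hz, rfl⟩
    exact Joined.map hz S.continuous
  · intro h
    refine ⟨S.symm y, ?_, by simp⟩
    have := Joined.map h S.symm.continuous
    rw [S.symm_apply_apply] at this
    exact this

theorem image_A [CompactSpace Y] [T2Space Y] (S : d.X ≃ₜ d.X) (k : ℤ) :
    ∃ m, S '' d.A k = d.A m := by
  have hx : d.sec (d.φ (k * d.τ)) ∈ d.A k := d.A_end rfl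
  set x := d.sec (d.φ (k * d.τ))
  have h1 := image_comp S x
  rw [d.A_eq hx] at h1
  have hnd : ¬ Dense (pathComponent (S x)) := by
    rw [← h1]
    intro h
    apply d.A_not_dense k
    have := S.symm.surjective.denseRange.dense_image S.symm.continuous h
    simpa [image_image] using this
  have hL : d.π (S x) ∈ range d.φ := by
    by_contra hc
    exact hnd (d.dense_comp hc)
  obtain ⟨m, hm⟩ := d.A_exists hL
  exact ⟨m, by rw [h1, d.A_eq hm]⟩

theorem rigid [CompactSpace Y] [T2Space Y] (S : d.X ≃ₜ d.X) : ∃ n : ℤ, S = hzpow d.T n := by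
  choose σ hσ using d.image_A S
  have hcl : ∀ k, S '' closure (d.A k) = closure (d.A (σ k)) := fun k => by
    rw [S.image_closure, hσ]
  have hbd : ∀ k x, x ∈ closure (d.A k) → x ∉ d.A k → d.π (S x) = d.φ ((σ k - 1 : ℤ) * d.τ) := by
    intro k x h1 h2
    apply d.A_bdry
    · rw [← hcl]; exact mem_image_of_mem _ h1
    · rw [← hσ]; rwa [S.injective.mem_set_image]
  have hstep : ∀ k, σ (k - 1) = σ k - 1 := by
    intro k
    obtain ⟨x, h1, h2⟩ := d.A_bdry_exists k
    have a1 := d.A_end (hbd k x h1 h2)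
    have a2 : S x ∈ d.A (σ (k - 1)) := by
      rw [← hσ]; exact mem_image_of_mem _ (d.A_end (d.A_bdry h1 h2))
    exact d.A_disj a2 a1
  have hσn : ∀ k, σ k = k + σ 0 := by
    intro k
    induction k with
    | zero => simp
    | succ k ih =>
      have := hstep (k + 1)
      rw [add_sub_cancel_right] at this
      omega
    | pred k ih =>
      have := hstep (-(k:ℤ))
      omega
  set n := σ 0
  refine ⟨n, ?_⟩
  obtain ⟨c, hc1, hc2⟩ := d.A_bdry_exists 0
  have hc := d.A_bdry hc1 hc2
  -- choose boundary points along the orbit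
  have hTA : ∀ k : ℤ, d.T '' d.A k = d.A (k + 1) := by
    intro k
    obtain ⟨m, hm⟩ := d.image_A d.T k
    have h1 : d.T (d.sec (d.φ (k * d.τ))) ∈ d.A m := by
      rw [← hm]; exact mem_image_of_mem _ (d.A_end rfl)
    have h2 : d.T (d.sec (d.φ (k * d.τ))) ∈ d.A (k + 1) := by
      apply d.A_end
      rw [π_T, π_sec, ← map_add]; congr 1; push_cast; ring
    rw [hm, d.A_disj h1 h2]
  have horb : ∀ k : ℕ, d.T^[k] c ∈ closure (d.A k) ∧ d.T^[k] c ∉ d.A k := by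
    intro k
    induction k with
    | zero => exact ⟨hc1, hc2⟩
    | succ k ih =>
      rw [Function.iterate_succ_apply']
      push_cast
      rw [← hTA, ← d.T.image_closure]
      exact ⟨mem_image_of_mem _ ih.1, by rw [d.T.injective.mem_set_image]; exact ih.2⟩
  have hπS : ∀ k : ℕ, d.π (S (d.T^[k] c)) = d.φ ((k + n - 1 : ℤ) * d.τ) := by
    intro k
    rw [hbd k _ (horb k).1 (horb k).2, hσn]
  have hπT : ∀ k : ℕ, d.π (hzpow d.T n (d.T^[k] c)) = d.φ ((k + n - 1 : ℤ) * d.τ) := by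
    intro k
    rw [π_hz, π_iter, hc, ← map_add, ← map_add]; congr 1; push_cast; ring
  have hdense : ∀ N : ℕ, Dense {x | ∃ k : ℕ, N ≤ k ∧ x = d.T^[k] c} := by
    intro N
    refine (d.minimal (d.T^[N] c)).mono ?_
    rintro _ ⟨k, rfl⟩
    exact ⟨k + N, by omega, by rw [Function.iterate_add_apply]⟩
  have e1 : (fun x => d.π (S x)) = fun x => d.π (hzpow d.T n x) := by
    refine Continuous.ext_on (hdense 0) (d.π_cont.comp S.continuous)
      (d.π_cont.comp (hzpow d.T n).continuous) ?_
    rintro _ ⟨k, -, rfl⟩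
    exact (hπS k).trans (hπT k).symm
  have e2 : ∀ j : ℤ, (fun x => (S x).1.2 j) = fun x => (hzpow d.T n x).1.2 j := by
    intro j
    refine Continuous.ext_on (hdense (2 + |n + j|).toNat) (by fun_prop) (by fun_prop) ?_
    rintro _ ⟨k, hk, rfl⟩
    have hne : d.φ ((k + n - 1 : ℤ) * d.τ) + d.φ (j * d.τ) ≠ 0 := by
      rw [Ne, φ_add_eq_zero]
      intro h
      have : ((k + n - 1 + j : ℤ) : ℝ) * d.τ = 0 := by push_cast at h ⊢; linarith
      rcases mul_eq_zero.1 this with h | h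
      · have : (k + n - 1 + j : ℤ) = 0 := by exact_mod_cast h
        have := neg_abs_le (n + j)
        omega
      · exact d.τpos.ne' h
    have f1 := d.coord (x := S (d.T^[k] c)) (k := j) (by rw [hπS]; exact hne)
    have f2 := d.coord (x := hzpow d.T n (d.T^[k] c)) (k := j) (by rw [hπT]; exact hne)
    rw [hπS] at f1
    rw [hπT] at f2
    exact f1.trans f2.symm
  ext1 x
  apply Subtype.ext
  apply Prod.ext
  · exact congrFun e1 x
  · funext j; exact congrFun (e2 j) x

end Data
end Slovak

namespace Slovak

/-- The dyadic solenoid. -/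
def sol : AddSubgroup (ℕ → AddCircle (1 : ℝ)) where
  carrier := {z | ∀ n, 2 • z (n + 1) = z n}
  add_mem' := by
    intro a b ha hb n
    simp only [Pi.add_apply, smul_add]
    rw [ha n, hb n]
  zero_mem' := by intro n; simp
  neg_mem' := by
    intro a ha n
    simp only [Pi.neg_apply, smul_neg]
    rw [ha n]

theorem sol_closed : IsClosed (sol : Set (ℕ → AddCircle (1 : ℝ))) := by
  have : (sol : Set (ℕ → AddCircle (1 : ℝ))) = ⋂ n, {z | 2 • z (n + 1) = z n} := by
    ext z; simp [sol]
  rw [this]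
  exact isClosed_iInter fun n => isClosed_eq (by fun_prop) (by fun_prop)

instance : CompactSpace sol := isCompact_iff_compactSpace.1 sol_closed.isCompact

theorem sol_pow (z : sol) (i n : ℕ) : 2 ^ n • z.1 (i + n) = z.1 i := by
  induction n with
  | zero => simp
  | succ n ih =>
    rw [← ih, pow_succ, mul_smul, ← z.2 (i + n)]; rfl

/-- The one-parameter subgroup. -/
noncomputable def flow : ℝ →+ sol where
  toFun t := ⟨fun n => ((t / 2 ^ n : ℝ) : AddCircle (1 : ℝ)), fun n => by
    rw [← AddCircle.coe_nsmul]; congr 1; rw [pow_succ, nsmul_eq_mul]; push_cast; field_simp⟩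
  map_zero' := by apply Subtype.ext; funext n; simp
  map_add' s t := by
    apply Subtype.ext; funext n
    change (((s + t) / 2 ^ n : ℝ) : AddCircle (1:ℝ)) = _
    rw [add_div, AddCircle.coe_add]; rfl

theorem flow_apply (t : ℝ) (n : ℕ) : (flow t).1 n = ((t / 2 ^ n : ℝ) : AddCircle (1 : ℝ)) := rfl

theorem flow_cont : Continuous flow := by
  refine Continuous.subtype_mk (continuous_pi fun n => ?_) _
  exact (AddCircle.continuous_mk' 1).comp (by fun_prop)

theorem flow_inj : Function.Injective flow := by
  rw [injective_iff_map_eq_zero]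
  intro t ht
  by_contra h0
  obtain ⟨n, hn⟩ := pow_unbounded_of_one_lt |t| (one_lt_two : (1:ℝ) < 2)
  have h1 : ((t / 2 ^ n : ℝ) : AddCircle (1 : ℝ)) = 0 := by
    rw [← flow_apply, ht]; rfl
  rw [AddCircle.coe_eq_zero_iff] at h1
  obtain ⟨m, hm⟩ := h1
  have h2 : |t / 2 ^ n| < 1 := by
    rw [abs_div, abs_of_pos (by positivity : (0:ℝ) < 2 ^ n), div_lt_one (by positivity)]; exact hn
  rw [← hm] at h2
  simp only [zsmul_eq_mul, mul_one] at h2 hm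
  have h3 : |m| < 1 := by exact_mod_cast h2
  rw [Int.abs_lt_one_iff] at h3
  rw [h3] at hm
  apply h0
  have : t / 2 ^ n = 0 := by rw [← hm]; simp
  rcases div_eq_zero_iff.1 this with h | h
  · exact h
  · exact absurd h (by positivity)

theorem flow_dense : DenseRange (fun n : ℤ => n • flow (√2)) := by
  intro y
  rw [mem_closure_iff_nhds]
  intro U hU
  rw [nhds_subtype_eq_comap, nhds_pi] at hU
  obtain ⟨V, hV, hVU⟩ := hU
  obtain ⟨I, hI, W, hW, hsub⟩ := Filter.mem_pi.1 hV
  obtain ⟨N, hN⟩ := hI.bddAbove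
  have hcont : ∀ i : ℕ, Continuous fun w : AddCircle (1:ℝ) => 2 ^ (N - i) • w := fun i => by fun_prop
  have hnh : {w : AddCircle (1:ℝ) | ∀ i ∈ I, 2 ^ (N - i) • w ∈ W i} ∈ 𝓝 (y.1 N) := by
    have := (Filter.biInter_mem hI).2 (fun i hi => by
      refine ((hcont i).tendsto (y.1 N)) ?_
      have := sol_pow y i (N - i)
      rw [Nat.add_sub_cancel' (hN hi)] at this
      simp only [this]
      exact hW i : ∀ i ∈ I, (fun w : AddCircle (1:ℝ) => 2 ^ (N - i) • w) ⁻¹' W i ∈ 𝓝 (y.1 N))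
    filter_upwards [this] with w hw i hi
    exact mem_iInter₂.1 hw i hi
  have hirr : Irrational (√2 / 2 ^ N / 1) := by
    have := irrational_sqrt_two.div_natCast (m := 2 ^ N) (by positivity)
    simpa using this
  have hd := AddCircle.denseRange_zsmul_coe_iff.2 hirr
  obtain ⟨_, hw, n, rfl⟩ := mem_closure_iff_nhds.1 (hd (y.1 N)) _ hnh
  refine ⟨n • flow (√2), hVU (hsub ?_), n, rfl⟩
  intro i hi
  have h1 := hw i hi
  have h2 := sol_pow (n • flow (√2)) i (N - i)
  rw [Nat.add_sub_cancel' (hN hi)] at h2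
  rw [← h2]
  exact h1

theorem flow_dense' (y : sol) : Dense (range fun n : ℕ => y + flow (n * √2)) := by
  have h := denseRange_zsmul_iff_nsmul.1 flow_dense
  have h2 := (Homeomorph.addLeft y).surjective.denseRange.comp h (Homeomorph.addLeft y).continuous
  have e : (fun n : ℕ => y + flow (n * √2)) = Homeomorph.addLeft y ∘ fun n : ℕ => n • flow (√2) := by
    funext n
    simp [← map_nsmul]
  rw [e]
  exact h2

theorem coord_cont (n : ℕ) : Continuous fun z : sol => z.1 n :=
  (continuous_apply n).comp continuous_subtype_val

instance : SecondCountableTopology (AddCircle (1 : ℝ)) :=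
  secondCountable_of_proper

instance : SecondCountableTopology sol :=
  TopologicalSpace.Subtype.secondCountableTopology _

instance : TopologicalSpace.MetrizableSpace sol :=
  TopologicalSpace.metrizableSpace_of_t3_secondCountable _

theorem flow_lift (γ : C(unitInterval, sol)) (t : ℝ) (h0 : γ 0 = flow t) :
    ∃ h : C(unitInterval, ℝ), h 0 = t ∧ ∀ s, γ s = flow (h s) := by
  obtain ⟨h, hh, hh0⟩ := (AddCircle.isCoveringMap_coe (1:ℝ)).exists_path_lifts
    ⟨fun s => (γ s).1 0, (coord_cont 0).comp γ.continuous⟩ t (by simp [h0, flow_apply])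
  refine ⟨h, hh0, ?_⟩
  have hh' : ∀ s, ((h s : ℝ) : AddCircle (1:ℝ)) = (γ s).1 0 := fun s => congrFun hh s
  intro s
  apply Subtype.ext
  funext n
  have hc : Continuous fun s => (γ s - flow (h s)).1 n :=
    (coord_cont n).comp (γ.continuous.sub (flow_cont.comp h.continuous))
  have hr : IsPreconnected (range fun s => (γ s - flow (h s)).1 n) := isPreconnected_range hc
  have hfin : (range fun s => (γ s - flow (h s)).1 n) ⊆ {u : AddCircle (1:ℝ) | 2 ^ n • u = 0} := by
    rintro _ ⟨s, rfl⟩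
    have := sol_pow (γ s - flow (h s)) 0 n
    rw [zero_add] at this
    rw [mem_ofPred_eq, this]
    change (γ s).1 0 - (flow (h s)).1 0 = 0
    rw [flow_apply, ← hh' s]; simp
  have htd := (AddCircle.finite_torsion (1:ℝ) (n := 2 ^ n) (by positivity)).countable.isTotallyDisconnected
  have hss := htd _ hfin hr
  have := hss ⟨s, rfl⟩ ⟨0, rfl⟩
  have e0 : γ 0 - flow (h 0) = 0 := by rw [h0, hh0, sub_self]
  simp only [e0] at this
  exact sub_eq_zero.1 this

theorem exists_data : Nonempty (Data sol) := by
  let _ : MetricSpace sol := TopologicalSpace.metrizableSpaceMetric sol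
  have K1c : IsCompact (flow '' Icc (-1) 0) := isCompact_Icc.image flow_cont
  have K2c : IsCompact (flow '' Icc 0 1) := isCompact_Icc.image flow_cont
  have hz1 : (0 : sol) ∈ flow '' Icc (-1) 0 := ⟨0, by norm_num, map_zero _⟩
  have hz2 : (0 : sol) ∈ flow '' Icc 0 1 := ⟨0, by norm_num, map_zero _⟩
  set D1 : sol → ℝ := fun y => Metric.infDist y (flow '' Icc (-1) 0) with hD1
  set D2 : sol → ℝ := fun y => Metric.infDist y (flow '' Icc 0 1) with hD2
  have c1 : Continuous D1 := Metric.continuous_infDist_pt _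
  have c2 : Continuous D2 := Metric.continuous_infDist_pt _
  have n1 : ∀ y, 0 ≤ D1 y := fun y => Metric.infDist_nonneg
  have n2 : ∀ y, 0 ≤ D2 y := fun y => Metric.infDist_nonneg
  have z1 : ∀ y, D1 y = 0 ↔ y ∈ flow '' Icc (-1) 0 := fun y =>
    (K1c.isClosed.mem_iff_infDist_zero ⟨0, hz1⟩).symm
  have z2 : ∀ y, D2 y = 0 ↔ y ∈ flow '' Icc 0 1 := fun y =>
    (K2c.isClosed.mem_iff_infDist_zero ⟨0, hz2⟩).symm
  have rz : ∀ y, D1 y + D2 y = 0 ↔ y = 0 := by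
    intro y
    constructor
    · intro h
      obtain ⟨s, hs, rfl⟩ := (z1 y).1 (by linarith [n1 y, n2 y])
      obtain ⟨t, ht, hst⟩ := (z2 (flow s)).1 (by linarith [n1 (flow s), n2 (flow s)])
      have := flow_inj hst
      have : s = 0 := by linarith [hs.2, ht.1]
      rw [this, map_zero]
    · rintro rfl
      rw [(z1 0).2 hz1, (z2 0).2 hz2, add_zero]
  have gle : ∀ y, |D1 y * Real.sin (1 / (D1 y + D2 y))| ≤ |D1 y + D2 y| := by
    intro y
    rw [abs_mul, abs_of_nonneg (n1 y), abs_of_nonneg (add_nonneg (n1 y) (n2 y))]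
    have := Real.abs_sin_le_one (1 / (D1 y + D2 y))
    nlinarith [n1 y, n2 y, abs_nonneg (Real.sin (1 / (D1 y + D2 y)))]
  refine ⟨{ φ := flow, cont := flow_cont, inj := flow_inj, τ := √2, τpos := by positivity,
            dense := flow_dense', lift := flow_lift,
            r := fun y => D1 y + D2 y, g := fun y => D1 y * Real.sin (1 / (D1 y + D2 y)),
            r_cont := c1.add c2, r_zero := rz, g_le := gle, g_cont := ?_, left := ?_, osc := ?_ }⟩
  · rw [continuous_iff_continuousAt]
    intro y
    by_cases hy : D1 y + D2 y = 0
    · have hg0 : D1 y * Real.sin (1 / (D1 y + D2 y)) = 0 := by rw [hy]; simp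
      rw [ContinuousAt, hg0]
      apply squeeze_zero_norm (a := fun y => |D1 y + D2 y|) (fun y => gle y)
      have : Continuous fun y => |D1 y + D2 y| := by fun_prop
      have h := this.tendsto y
      simpa [hy] using h
    · refine c1.continuousAt.mul (Real.continuous_sin.continuousAt.comp ?_)
      exact continuousAt_const.div (c1.add c2).continuousAt hy
  · refine ⟨1, one_pos, fun t ht => ?_⟩
    rw [(z1 _).2 ⟨t, ht, rfl⟩, zero_mul]
  · intro η hη v hv
    set b := min (η / 2) 1 with hb
    have hb0 : 0 < b := lt_min (by linarith) one_pos
    have hb1 : b ≤ 1 := min_le_right _ _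
    have hbη : b < η := (min_le_left _ _).trans_lt (by linarith)
    have cc : ContinuousOn (fun t => D1 (flow t)) (Icc 0 b) := (c1.comp flow_cont).continuousOn
    have hpos : 0 < D1 (flow b) := by
      refine lt_of_le_of_ne (n1 _) fun h => ?_
      obtain ⟨s, hs, hsb⟩ := (z1 _).1 h.symm
      have := flow_inj hsb
      linarith [hs.2]
    obtain ⟨N, hN⟩ := exists_nat_gt ((1 / D1 (flow b) + Real.pi) / (2 * Real.pi))
    have hpi := Real.pi_pos
    rw [div_lt_iff₀ (by positivity)] at hN
    set θ := Real.arcsin v + N * (2 * Real.pi) with hθ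
    have hθ1 : 1 / D1 (flow b) < θ := by
      have := Real.neg_pi_div_two_le_arcsin v
      linarith
    have hθ0 : 0 < θ := lt_trans (by positivity) hθ1
    have hmem : 1 / θ ∈ Icc (D1 (flow 0)) (D1 (flow b)) := by
      rw [map_zero, (z1 0).2 hz1]
      refine ⟨by positivity, ?_⟩
      rw [div_le_iff₀ hθ0]
      rw [div_lt_iff₀ hpos] at hθ1
      linarith
    obtain ⟨t, ht, htθ⟩ := intermediate_value_Icc hb0.le cc hmem
    simp only at htθ
    have ht0 : 0 < t := by
      refine lt_of_le_of_ne ht.1 ?_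
      rintro rfl
      rw [map_zero, (z1 0).2 hz1] at htθ
      have : 0 < 1 / θ := by positivity
      linarith
    refine ⟨t, ⟨ht0, ht.2.trans_lt hbη⟩, ?_⟩
    have h2 : D2 (flow t) = 0 := (z2 _).2 ⟨t, ⟨ht0.le, ht.2.trans hb1⟩, rfl⟩
    simp only [h2, add_zero]
    rw [htθ, one_div_one_div, hθ, Real.sin_add_nat_mul_two_pi, Real.sin_arcsin hv.1 hv.2, mul_comm]

end Slovak

/-- Slovak spaces exist: there is a compact metric space with at least three points carrying a
minimal homeomorphism `T` such that every self-homeomorphism equals `Tⁿ` for some `n : ℤ`. -/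
theorem exists_slovak_space :
    ∃ (X : Type) (_ : MetricSpace X), CompactSpace X ∧
      (∃ a b c : X, a ≠ b ∧ a ≠ c ∧ b ≠ c) ∧
      ∃ T : X ≃ₜ X, IsMinimal ⇑T ∧ ∀ S : X ≃ₜ X, ∃ n : ℤ, S = hzpow T n := by
  obtain ⟨d⟩ := Slovak.exists_data
  have hcs : CompactSpace d.X := isCompact_iff_compactSpace.1 d.C_compact
  have : TopologicalSpace.MetrizableSpace d.X :=
    TopologicalSpace.metrizableSpace_of_t3_secondCountable _
  refine ⟨d.X, TopologicalSpace.metrizableSpaceMetric d.X, hcs, ?_, d.T, d.minimal, d.rigid⟩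
  have hne : ∀ s t : ℝ, s ≠ t → d.sec (d.φ s) ≠ d.sec (d.φ t) := fun s t hst h =>
    hst (d.inj (congrArg d.π h))
  exact ⟨_, _, _, hne 0 1 (by norm_num), hne 0 2 (by norm_num), hne 1 2 (by norm_num)⟩
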